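/- arXiv:0904.3573 — 2 statements merged into one kernel-verified Lean document; each statement's English description precedes it below -/
import Mathlib

section
/- Identify ℝ² with ℂ (with basis e₁ = 1, e₂ = i) and let F = ℂⁿ regarded as a real normed space. Let J : F → (F →L[ℝ] F) be a smooth map with J(u(0)) equal to scalar multiplication by i, and let u be a smooth F-valued map on a neighborhood U of 0 in ℂ satisfying fderiv ℝ u z e₁ + J(u z)(fderiv ℝ u z e₂) = 0 for all z ∈ U. Assume iteratedFDeriv ℝ j u 0 = 0 for all 1 ≤ j ≤ k. Then the (k+1)-st derivative A = iteratedFDeriv ℝ (k+1) u 0 is complex multilinear: for all v₁,…,v_{k+1} ∈ ℂ and each index ℓ, A(v₁,…,i·v_ℓ,…,v_{k+1}) = i • A(v₁,…,v_{k+1}). -/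
open Complex

section Symmetry

variable {E F : Type*} [NormedAddCommGroup E] [NormedSpace ℝ E]
  [NormedAddCommGroup F] [NormedSpace ℝ F]

/-- The `(n + 1)`-st derivative of a real `C^(n+1)` function is invariant under exchanging two
adjacent arguments. -/
theorem iteratedFDeriv_comp_swap_of_contDiffAt {f : E → F} {x : E} {n : ℕ}
    (hf : ContDiffAt ℝ (n + 1 : ℕ) f x) (v : Fin (n + 1) → E) (i : Fin n) :
    iteratedFDeriv ℝ (n + 1) f x (v ∘ Equiv.swap i.castSucc i.succ) =
      iteratedFDeriv ℝ (n + 1) f x v := by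
  induction n generalizing x with
  | zero => exact i.elim0
  | succ n ih =>
    have hdiff : ∀ {y : E} {m : ℕ}, m < n + 2 → ContDiffAt ℝ (n + 2 : ℕ) f y →
        DifferentiableAt ℝ (iteratedFDeriv ℝ m f) y := fun {y m} hm hy =>
      (hy.iteratedFDeriv_right (m := 1) (i := m) (by norm_cast; omega)).differentiableAt
        one_ne_zero
    have hev : ∀ᶠ y in nhds x, ContDiffAt ℝ (n + 2 : ℕ) f y := hf.eventually (by simp)
    rw [DifferentiableAt.iteratedFDeriv_succ_apply_left' (hdiff (by omega) hf),
      DifferentiableAt.iteratedFDeriv_succ_apply_left' (hdiff (by omega) hf)]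
    induction i using Fin.cases with
    | zero =>
      have hC2 : ContDiffAt ℝ 2
          (fun y => iteratedFDeriv ℝ n f y (Fin.tail (Fin.tail v))) x :=
        (ContinuousMultilinearMap.apply ℝ (fun _ : Fin n => E) F
          (Fin.tail (Fin.tail v))).contDiff.contDiffAt.comp x
          (hf.iteratedFDeriv_right (m := 2) (i := n) (by norm_cast; omega))
      have hsymm := hC2.isSymmSndFDerivAt (by simp)
      have hd := (hC2.fderiv_right (m := 1) (by norm_num)).differentiableAt one_ne_zero
      have key : ∀ w : Fin (n + 2) → E, Fin.tail (Fin.tail w) = Fin.tail (Fin.tail v) →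
          fderiv ℝ (fun y => iteratedFDeriv ℝ (n + 1) f y (Fin.tail w)) x (w 0) =
          fderiv ℝ (fderiv ℝ fun y => iteratedFDeriv ℝ n f y (Fin.tail (Fin.tail v))) x
            (w 0) (w 1) := by
        intro w hw
        have : (fun y => iteratedFDeriv ℝ (n + 1) f y (Fin.tail w)) =ᶠ[nhds x]
            fun y => fderiv ℝ (fun y => iteratedFDeriv ℝ n f y (Fin.tail (Fin.tail v))) y
              (w 1) := by
          filter_upwards [hev] with y hy
          rw [DifferentiableAt.iteratedFDeriv_succ_apply_left' (hdiff (by omega) hy), hw]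
          rfl
        rw [this.fderiv_eq, fderiv_clm_apply hd (by fun_prop)]
        simp
      rw [key v rfl, key]
      · simpa using hsymm _ _
      · funext j
        simp only [Fin.tail, Function.comp_apply]
        rw [Equiv.swap_apply_of_ne_of_ne] <;> simp [Fin.ext_iff]
    | succ j =>
      have h0 : (v ∘ Equiv.swap j.succ.castSucc j.succ.succ) 0 = v 0 := by
        simp only [Function.comp_apply]
        rw [Equiv.swap_apply_of_ne_of_ne] <;> simp [Fin.ext_iff]
      have htail : Fin.tail (v ∘ Equiv.swap j.succ.castSucc j.succ.succ) =
          Fin.tail v ∘ Equiv.swap j.castSucc j.succ := by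
        funext l
        simp only [Fin.tail, Function.comp_apply]
        rw [← Fin.succ_castSucc, (Fin.succ_injective _).map_swap]
      rw [h0, htail]
      congr 1
      apply Filter.EventuallyEq.fderiv_eq
      filter_upwards [hev] with y hy
      exact ih (hy.of_le (by norm_cast; omega)) _ _

/-- The `n`-th derivative of a real `C^n` function is symmetric. -/
theorem iteratedFDeriv_comp_perm_of_contDiffAt {f : E → F} {x : E} {n : ℕ}
    (hf : ContDiffAt ℝ n f x) (v : Fin n → E) (σ : Equiv.Perm (Fin n)) :
    iteratedFDeriv ℝ n f x (v ∘ σ) = iteratedFDeriv ℝ n f x v := by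
  cases n with
  | zero => exact congrArg _ (Subsingleton.elim _ _)
  | succ n =>
    have hσ : σ ∈ Submonoid.closure
        (Set.range fun i : Fin n => Equiv.swap i.castSucc i.succ) := by
      rw [Equiv.Perm.mclosure_swap_castSucc_succ]; trivial
    induction hσ using Submonoid.closure_induction generalizing v with
    | mem σ hσ =>
      obtain ⟨i, rfl⟩ := hσ
      exact iteratedFDeriv_comp_swap_of_contDiffAt hf v i
    | one => rfl
    | mul σ τ _ _ hσ hτ => exact (hτ (v ∘ σ)).trans (hσ v)

end Symmetry

section Leibniz

variable {D F G : Type*} [NormedAddCommGroup D] [NormedSpace ℝ D]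
  [NormedAddCommGroup F] [NormedSpace ℝ F] [NormedAddCommGroup G] [NormedSpace ℝ G]

/-- If `f x = 0` and `g` has vanishing derivatives of order `< k` at `x`, then the `k`-th
derivative of `y ↦ f y (g y)` vanishes at `x`. -/
theorem iteratedFDeriv_clm_apply_eq_zero {f : D → F →L[ℝ] G} {g : D → F} {x : D} {k : ℕ}
    (hf : ContDiffAt ℝ k f x) (hg : ContDiffAt ℝ k g x) (hfx : f x = 0)
    (hgx : ∀ j < k, iteratedFDeriv ℝ j g x = 0) :
    iteratedFDeriv ℝ k (fun y => f y (g y)) x = 0 := by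
  obtain ⟨s, hs, hso, hxs⟩ := eventually_nhds_iff.1
    ((hf.eventually (by simp)).and (hg.eventually (by simp)))
  have h := norm_iteratedFDerivWithin_clm_apply (n := k)
    (fun y hy => (hs y hy).1.contDiffWithinAt) (fun y hy => (hs y hy).2.contDiffWithinAt)
    hso.uniqueDiffOn hxs le_rfl
  simp only [iteratedFDerivWithin_of_isOpen _ hso hxs] at h
  refine norm_le_zero_iff.1 (h.trans_eq (Finset.sum_eq_zero fun i _ => ?_))
  rcases Nat.eq_zero_or_pos i with rfl | hi
  · simp [hfx]
  · rcases Nat.eq_zero_or_pos k with rfl | hk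
    · simp_all
    · simp [hgx (k - i) (by omega)]

end Leibniz

theorem principal_jet_is_complex_multilinear (n k : ℕ)
    (J : (Fin n → ℂ) → ((Fin n → ℂ) →L[ℝ] (Fin n → ℂ))) (hJ : ContDiff ℝ (⊤ : ℕ∞) J)
    (u : ℂ → (Fin n → ℂ)) (U : Set ℂ) (hU : U ∈ nhds (0 : ℂ))
    (hu : ContDiffOn ℝ (⊤ : ℕ∞) u U)
    (hJ0 : ∀ v : Fin n → ℂ, J (u 0) v = Complex.I • v)
    (hCR : ∀ z ∈ U, fderiv ℝ u z 1 + J (u z) (fderiv ℝ u z Complex.I) = 0)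
    (hjet : ∀ j : ℕ, 1 ≤ j → j ≤ k → iteratedFDeriv ℝ j u 0 = 0) :
    ∀ (v : Fin (k + 1) → ℂ) (ℓ : Fin (k + 1)),
      iteratedFDeriv ℝ (k + 1) u 0 (Function.update v ℓ (Complex.I * v ℓ)) =
        Complex.I • iteratedFDeriv ℝ (k + 1) u 0 v := by
  have huA : ContDiffAt ℝ (⊤ : ℕ∞) u 0 := hu.contDiffAt hU
  have hdu : ContDiffAt ℝ k (fderiv ℝ u) 0 := huA.fderiv_right (by exact_mod_cast le_top)
  let ev (w : ℂ) : (ℂ →L[ℝ] (Fin n → ℂ)) →L[ℝ] (Fin n → ℂ) :=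
    ContinuousLinearMap.apply ℝ (Fin n → ℂ) w
  have hev : ∀ j < k, iteratedFDeriv ℝ j (fun z => fderiv ℝ u z I) 0 = 0 := by
    intro j hj
    have hz : iteratedFDeriv ℝ j (fderiv ℝ u) 0 = 0 := by
      rw [← norm_eq_zero, norm_iteratedFDeriv_fderiv, hjet (j + 1) (by omega) (by omega),
        norm_zero]
    have h := (ev I).iteratedFDeriv_comp_left hdu (i := j) (by exact_mod_cast hj.le)
    rw [hz] at h
    refine h.trans ?_
    ext m
    simp
  have hzero : iteratedFDeriv ℝ k (fun z => (J (u 0) - J (u z)) (fderiv ℝ u z I)) 0 = 0 := by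
    refine iteratedFDeriv_clm_apply_eq_zero ?_ (hdu.clm_apply contDiffAt_const) (sub_self _) hev
    exact contDiffAt_const.sub
      ((hJ.contDiffAt.comp (0 : ℂ) huA).of_le (by exact_mod_cast le_top))
  have heq : (ev 1 + (J (u 0)).comp (ev I)) ∘ fderiv ℝ u =ᶠ[nhds 0]
      fun z => (J (u 0) - J (u z)) (fderiv ℝ u z I) := by
    filter_upwards [hU] with z hz
    have h := eq_neg_of_add_eq_zero_left (hCR z hz)
    simp only [ev, Function.comp_apply, add_apply, ContinuousLinearMap.comp_apply,
      ContinuousLinearMap.apply_apply, sub_apply, h]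
    abel
  have hlin := (ev 1 + (J (u 0)).comp (ev I)).iteratedFDeriv_comp_left hdu (i := k) le_rfl
  rw [(heq.iteratedFDeriv (𝕜 := ℝ) k).eq_of_nhds, hzero] at hlin
  -- complex linearity in the last variable, on which the first-order equation acts
  have hlast : ∀ (m : Fin k → ℂ) (w : ℂ), iteratedFDeriv ℝ k (fderiv ℝ u) 0 m (I * w) =
      I • iteratedFDeriv ℝ k (fderiv ℝ u) 0 m w := by
    intro m w
    set L := iteratedFDeriv ℝ k (fderiv ℝ u) 0 m with hL
    have h1 : L 1 + I • L I = 0 := by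
      have h := congrArg (fun T => T m) hlin
      simpa [ev, hJ0, ← hL] using h.symm
    have hI : L I = I • L 1 := by
      rw [eq_neg_of_add_eq_zero_left h1, smul_neg, smul_smul, I_mul_I, neg_one_smul, neg_neg]
    have hw : w = w.re • (1 : ℂ) + w.im • I := by
      simp [Complex.re_add_im]
    have hIw : I * w = w.re • I - w.im • (1 : ℂ) := by
      apply Complex.ext <;> simp
    rw [hIw, map_sub, map_smul, map_smul]
    conv_rhs => rw [hw, map_add, map_smul, map_smul]
    rw [hI, smul_add, smul_comm I w.re, smul_comm I w.im, smul_smul I I, I_mul_I, neg_one_smul,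
      smul_neg, sub_eq_add_neg]
  intro v ℓ
  have hperm := fun w : Fin (k + 1) → ℂ => iteratedFDeriv_comp_perm_of_contDiffAt (n := k + 1)
    (huA.of_le (by exact_mod_cast le_top)) w (Equiv.swap ℓ (Fin.last k))
  rw [← hperm, ← hperm v, iteratedFDeriv_succ_apply_right, iteratedFDeriv_succ_apply_right]
  have hinit : Fin.init (Function.update v ℓ (I * v ℓ) ∘ Equiv.swap ℓ (Fin.last k)) =
      Fin.init (v ∘ Equiv.swap ℓ (Fin.last k)) := by
    funext j
    have hj : Equiv.swap ℓ (Fin.last k) j.castSucc ≠ ℓ := by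
      rw [Ne, Equiv.swap_apply_eq_iff, Equiv.swap_apply_left]
      exact j.castSucc_ne_last
    simp [Fin.init, Function.update_of_ne hj]
  rw [hinit]
  simpa using hlast (Fin.init (v ∘ Equiv.swap ℓ (Fin.last k))) (v ℓ)
end

section
/- Identify ℝ² with ℂ (with basis e₁ = 1, e₂ = i) and let F = ℂⁿ regarded as a real normed space. Let J : F → (F →L[ℝ] F) be a smooth map with J(u(0)) equal to scalar multiplication by i, and let u be a smooth F-valued map on a neighborhood U of 0 in ℂ satisfying fderiv ℝ u z e₁ + J(u z)(fderiv ℝ u z e₂) = 0 for all z ∈ U. Assume iteratedFDeriv ℝ j u 0 = 0 for all 1 ≤ j ≤ k. Then there exists a vector a ∈ ℂⁿ such that u(z) − u(0) − z^{k+1} • a = o(|z|^{k+1}) as z → 0, where z^{k+1} • a denotes complex scalar multiplication in ℂⁿ. -/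
open Complex Filter Topology Asymptotics

section VanishingJets

universe v

variable {E G H : Type v} [NormedAddCommGroup E] [NormedSpace ℝ E]
  [NormedAddCommGroup G] [NormedSpace ℝ G] [NormedAddCommGroup H] [NormedSpace ℝ H]

/-- The derivatives of `f` at `x` of all orders `≤ n`, including order zero, vanish. -/
def VanishingJet (n : ℕ) (f : E → G) (x : E) : Prop :=
  ∀ j ≤ n, iteratedFDeriv ℝ j f x = 0

namespace VanishingJet

theorem congr {n : ℕ} {f g : E → G} {x : E} (hf : VanishingJet n f x) (h : g =ᶠ[𝓝 x] f) :
    VanishingJet n g x := fun j hj => by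
  rw [(h.iteratedFDeriv ℝ j).eq_of_nhds, hf j hj]

theorem apply_eq_zero {n : ℕ} {f : E → G} {x : E} (hf : VanishingJet n f x) : f x = 0 := by
  rw [← norm_eq_zero, ← norm_iteratedFDeriv_zero (𝕜 := ℝ), hf 0 n.zero_le, norm_zero]

theorem fderiv {n : ℕ} {f : E → G} {x : E}
    (hf : ∀ j, 1 ≤ j → j ≤ n + 1 → iteratedFDeriv ℝ j f x = 0) :
    VanishingJet n (fderiv ℝ f) x := fun j hj => by
  rw [← norm_eq_zero, norm_iteratedFDeriv_fderiv, hf (j + 1) (by omega) (by omega), norm_zero]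

theorem clm_comp {n : ℕ} {f : E → G} {x : E} (hf : VanishingJet n f x) (L : G →L[ℝ] H)
    (hc : ContDiffAt ℝ (⊤ : ℕ∞) f x) : VanishingJet n (fun y => L (f y)) x := fun j hj => by
  have : iteratedFDeriv ℝ j (fun y => L (f y)) x = _ :=
    L.iteratedFDeriv_comp_left hc (i := j) (by exact_mod_cast le_top)
  rw [hf j hj] at this
  ext m
  simpa using congrArg (fun T => T m) this

/-- A function whose derivatives of order at most `n` vanish at `x` is `o(‖y - x‖ ^ n)`. -/
theorem isLittleO {n : ℕ} {f : E → G} {x : E} (hf : VanishingJet n f x)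
    (hc : ContDiffAt ℝ (⊤ : ℕ∞) f x) : f =o[𝓝 x] fun y => ‖y - x‖ ^ n := by
  induction n generalizing G with
  | zero =>
    simpa [isLittleO_one_iff, hf.apply_eq_zero] using hc.continuousAt.tendsto
  | succ n ih =>
    have hd := ih (VanishingJet.fderiv fun j _ hj => hf j hj) (hc.fderiv_right (by simp))
    obtain ⟨r, hr, hball⟩ := Metric.eventually_nhds_iff_ball.1
      ((hc.of_le (m := 1) (by exact_mod_cast le_top)).eventually (by simp))
    have := (convex_ball x r).isLittleO_pow_succ (Metric.mem_ball_self hr)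
      (fun y hy => ((hball y hy).differentiableAt (by simp)).hasFDerivAt.hasFDerivWithinAt)
      (hd.mono nhdsWithin_le_nhds)
    rw [nhdsWithin_eq_nhds.2 (Metric.ball_mem_nhds x hr)] at this
    simpa [hf.apply_eq_zero] using this

/-- If `A x = 0` and the derivatives of `w` of order `< n` vanish at `x`, then the derivatives of
`A w` of order `≤ n` vanish at `x`. -/
theorem clm_apply {n : ℕ} {A : E → G →L[ℝ] H} {w : E → G} {x : E}
    (hA : ContDiffAt ℝ (⊤ : ℕ∞) A x) (hw : ContDiffAt ℝ (⊤ : ℕ∞) w x) (hA0 : A x = 0)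
    (hw0 : ∀ j < n, iteratedFDeriv ℝ j w x = 0) :
    VanishingJet n (fun y => A y (w y)) x := fun j hj => by
  obtain ⟨r, hr, hball⟩ := Metric.eventually_nhds_iff_ball.1
    (((hA.of_le (m := j) (by exact_mod_cast le_top)).eventually (by simp)).and
      ((hw.of_le (m := j) (by exact_mod_cast le_top)).eventually (by simp)))
  have hx := Metric.mem_ball_self (x := x) hr
  have := (ContinuousLinearMap.id ℝ (G →L[ℝ] H)).norm_iteratedFDerivWithin_le_of_bilinear
    (fun y hy => (hball y hy).1.contDiffWithinAt) (fun y hy => (hball y hy).2.contDiffWithinAt)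
    Metric.isOpen_ball.uniqueDiffOn hx le_rfl
  simp only [iteratedFDerivWithin_of_isOpen _ Metric.isOpen_ball hx] at this
  rw [Finset.sum_eq_zero] at this
  · simpa using this
  · rintro (_ | i) hi
    · simp [hA0]
    · rw [hw0 _ (by grind)]
      simp

end VanishingJet

end VanishingJets

section Dbar

variable {G : Type} [NormedAddCommGroup G] [NormedSpace ℂ G] [NormedSpace ℝ G]
  [IsScalarTower ℝ ℂ G]

/-- The linear map `T ↦ T 1 + i T i`, twice the complex antilinear part of `T` evaluated at `1`. -/
noncomputable def dbarCLM (G : Type*) [NormedAddCommGroup G] [NormedSpace ℂ G] [NormedSpace ℝ G]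
    [IsScalarTower ℝ ℂ G] : (ℂ →L[ℝ] G) →L[ℝ] G :=
  ContinuousLinearMap.apply ℝ G (1 : ℂ) + I • ContinuousLinearMap.apply ℝ G I

theorem dbarCLM_apply (T : ℂ →L[ℝ] G) : dbarCLM G T = T 1 + I • T I := rfl

theorem apply_eq_smul_sub_im_smul_dbarCLM (T : ℂ →L[ℝ] G) (v : ℂ) :
    T v = v • T 1 - ((v.im : ℂ) * I) • dbarCLM G T := by
  have hs (r : ℝ) (x : G) : r • x = (r : ℂ) • x := (algebraMap_smul ℂ r x).symm
  have h : T v = (v.re : ℂ) • T 1 + (v.im : ℂ) • T I := by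
    conv_lhs => rw [← re_add_im v, show (v.re : ℂ) + v.im * I = v.re • (1 : ℂ) + v.im • I by simp]
    simp only [map_add, map_smul, hs]
  rw [h, dbarCLM_apply]
  nth_rw 3 [← re_add_im v]
  simp only [smul_add, smul_smul, add_smul, mul_assoc, I_mul_I]
  module

/-- The Taylor expansion, at a point where the derivatives of order `1, …, k` vanish, of a map
whose Cauchy-Riemann defect has vanishing `k`-jet. -/
theorem exists_isLittleO_sub_pow_smul_of_vanishingJet_dbar {k : ℕ} {f : ℂ → G}
    (hc : ContDiffAt ℝ (⊤ : ℕ∞) f 0)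
    (hf : ∀ j, 1 ≤ j → j ≤ k → iteratedFDeriv ℝ j f 0 = 0)
    (hd : VanishingJet k (fun z => dbarCLM G (fderiv ℝ f z)) 0) :
    ∃ a : G, (fun z : ℂ => f z - f 0 - z ^ (k + 1) • a) =o[𝓝 0] fun z : ℂ => ‖z‖ ^ (k + 1) := by
  induction k generalizing f with
  | zero =>
    refine ⟨fderiv ℝ f 0 1, ?_⟩
    have h := (hc.differentiableAt (by simp)).hasFDerivAt.isLittleO
    simp only [sub_zero] at h
    have h0 := hd.apply_eq_zero
    refine (h.congr_left fun z => ?_).trans_isBigO 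
      (by simpa using (isBigO_refl (fun z : ℂ => z) (𝓝 0)).norm_right)
    rw [apply_eq_smul_sub_im_smul_dbarCLM, h0]
    simp
  | succ k ih =>
    have hc' : ContDiffAt ℝ (⊤ : ℕ∞) (fderiv ℝ f) 0 := hc.fderiv_right (by simp)
    have hcd : ContDiffAt ℝ (⊤ : ℕ∞) (fun z => dbarCLM G (fderiv ℝ f z)) 0 :=
      (dbarCLM G).contDiff.contDiffAt.comp 0 hc'
    have hjet : VanishingJet k (fun z => fderiv ℝ f z 1) 0 :=
      (VanishingJet.fderiv hf).clm_comp (ContinuousLinearMap.apply ℝ G (1 : ℂ)) hc'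
    have hcomm : (fun z => dbarCLM G (fderiv ℝ (fun y => fderiv ℝ f y 1) z)) =ᶠ[𝓝 0]
        fun z => fderiv ℝ (fun y => dbarCLM G (fderiv ℝ f y)) z 1 := by
      filter_upwards [(hc.of_le (m := 2) (WithTop.coe_le_coe.2 le_top)).eventually (by simp)]
        with z hz
      have hdz : DifferentiableAt ℝ (fderiv ℝ f) z :=
        (hz.fderiv_right (m := 1) (by norm_num)).differentiableAt (by simp)
      have h1 := ((ContinuousLinearMap.apply ℝ G (1 : ℂ)).hasFDerivAt.comp z hdz.hasFDerivAt).fderiv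
      have h2 := ((dbarCLM G).hasFDerivAt.comp z hdz.hasFDerivAt).fderiv
      have hsymm := hz.isSymmSndFDerivAt (by simp) 1 I
      simp only [Function.comp_def, ContinuousLinearMap.apply_apply] at h1 h2
      rw [h1, h2]
      simp [dbarCLM_apply, hsymm]
    obtain ⟨b, hb⟩ := ih (f := fun z => fderiv ℝ f z 1)
      ((ContinuousLinearMap.apply ℝ G (1 : ℂ)).contDiff.contDiffAt.comp 0 hc')
      (fun j _ hj => hjet j hj)
      (((VanishingJet.fderiv fun j _ hj => hd j hj).clm_comp
        (ContinuousLinearMap.apply ℝ G (1 : ℂ)) (hcd.fderiv_right (by simp))).congr hcomm)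
    simp only [hjet.apply_eq_zero, sub_zero] at hb
    have hdo : (fun z => dbarCLM G (fderiv ℝ f z)) =o[𝓝 0] fun z : ℂ => ‖z‖ ^ (k + 1) := by
      simpa using hd.isLittleO hcd
    set a : G := ((k : ℂ) + 2)⁻¹ • b with ha
    have hk : (k : ℂ) + 2 ≠ 0 := by exact_mod_cast (by omega : k + 2 ≠ 0)
    refine ⟨a, ?_⟩
    let P' : ℂ → ℂ →L[ℝ] G := fun z =>
      ((ContinuousLinearMap.toSpanSingleton ℂ (z ^ (k + 1) • b)).restrictScalars ℝ)
    have hP (z : ℂ) : HasFDerivAt (fun z : ℂ => z ^ (k + 1 + 1) • a) (P' z) z := by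
      have h := (((hasDerivAt_pow (k + 1 + 1) z).smul_const a).hasFDerivAt).restrictScalars ℝ
      have hb' : z ^ (k + 1) • b = (((k + 1 + 1 : ℕ) : ℂ) * z ^ (k + 1)) • a := by
        rw [ha, smul_smul]
        congr 1
        push_cast
        field_simp
        ring
      simpa [P', hb'] using h
    obtain ⟨r, hr, hball⟩ := Metric.eventually_nhds_iff_ball.1
      ((hc.of_le (m := 1) (by exact_mod_cast le_top)).eventually (by simp))
    have hfd : (fun z => fderiv ℝ f z - P' z) =o[𝓝 0] fun z : ℂ => ‖z‖ ^ (k + 1) := by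
      refine IsBigO.trans_isLittleO (.of_bound 1 (.of_forall fun z => ?_))
        (hb.norm_left.add hdo.norm_left)
      rw [one_mul, Real.norm_of_nonneg (by positivity)]
      refine ContinuousLinearMap.opNorm_le_bound _ (by positivity) fun v => ?_
      have : (fderiv ℝ f z - P' z) v = v • (fderiv ℝ f z 1 - z ^ (k + 1) • b) -
          ((v.im : ℂ) * I) • dbarCLM G (fderiv ℝ f z) := by
        rw [_root_.sub_apply, apply_eq_smul_sub_im_smul_dbarCLM]
        simp only [P', ContinuousLinearMap.coe_restrictScalars',
          ContinuousLinearMap.toSpanSingleton_apply, smul_sub]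
        abel
      rw [this, add_mul]
      refine (norm_sub_le _ _).trans (add_le_add ?_ ?_)
      · rw [norm_smul, mul_comm]
      · rw [norm_smul, mul_comm]
        gcongr
        simpa using abs_im_le_norm v
    have := (convex_ball (0 : ℂ) r).isLittleO_pow_succ (n := k + 1) (Metric.mem_ball_self hr)
      (fun z hz => (((hball z hz).differentiableAt (by simp)).hasFDerivAt.sub
        (hP z)).hasFDerivWithinAt)
      (by simpa using hfd.mono nhdsWithin_le_nhds)
    rw [nhdsWithin_eq_nhds.2 (Metric.ball_mem_nhds 0 hr)] at this
    refine (this.congr (fun z => ?_) fun z => ?_)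
    · simp
      abel
    · simp

end Dbar

theorem taylor_expansion_J_holomorphic (n k : ℕ)
    (J : (Fin n → ℂ) → ((Fin n → ℂ) →L[ℝ] (Fin n → ℂ))) (hJ : ContDiff ℝ (⊤ : ℕ∞) J)
    (u : ℂ → (Fin n → ℂ)) (U : Set ℂ) (hU : U ∈ nhds (0 : ℂ))
    (hu : ContDiffOn ℝ (⊤ : ℕ∞) u U)
    (hJ0 : ∀ v : Fin n → ℂ, J (u 0) v = Complex.I • v)
    (hCR : ∀ z ∈ U, fderiv ℝ u z 1 + J (u z) (fderiv ℝ u z Complex.I) = 0)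
    (hjet : ∀ j : ℕ, 1 ≤ j → j ≤ k → iteratedFDeriv ℝ j u 0 = 0) :
    ∃ a : Fin n → ℂ,
      (fun z : ℂ => u z - u 0 - z ^ (k + 1) • a) =o[𝓝 0]
        (fun z : ℂ => ‖z‖ ^ (k + 1)) := by
  have hc : ContDiffAt ℝ (⊤ : ℕ∞) u 0 := hu.contDiffAt hU
  have hc' : ContDiffAt ℝ (⊤ : ℕ∞) (fderiv ℝ u) 0 := hc.fderiv_right (by simp)
  let L := ContinuousLinearMap.apply ℝ (Fin n → ℂ) I
  have hw0 : ∀ j < k, iteratedFDeriv ℝ j (fun z => fderiv ℝ u z I) 0 = 0 := by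
    intro j hj
    exact (VanishingJet.fderiv fun i hi hij => hjet i hi (by omega)).clm_comp L hc' j le_rfl
  have hA : ContDiffAt ℝ (⊤ : ℕ∞)
      (fun z => I • ContinuousLinearMap.id ℝ (Fin n → ℂ) - J (u z)) 0 :=
    contDiffAt_const.sub (hJ.contDiffAt.comp 0 hc)
  refine exists_isLittleO_sub_pow_smul_of_vanishingJet_dbar hc hjet
    ((VanishingJet.clm_apply hA (L.contDiff.contDiffAt.comp 0 hc') ?_ hw0).congr ?_)
  · ext1 v
    simp [hJ0]
  · filter_upwards [hU] with z hz
    simp [L, dbarCLM_apply, eq_neg_of_add_eq_zero_left (hCR z hz), sub_eq_neg_add]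
end
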